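/- Let n ≥ 4 be even and let τ be a transposition in Sym(n). Then, as rational numbers, |{S ⊆ {0,…,n−1} : |S| = n/2 and τ(S) = S}| / C(n, n/2) = 1/3 + (n−4)/(6(n−1)). -/

import Mathlib

theorem aux_image {n : ℕ} (a b : Fin n) (S : Finset (Fin n)) :
    S.image (Equiv.swap a b) = S ↔ (a ∈ S ↔ b ∈ S) := by
  have key : ∀ x, x ∈ S.image (Equiv.swap a b) ↔ Equiv.swap a b x ∈ S := by
    intro x
    rw [Finset.mem_image]
    constructor
    · rintro ⟨y, hy, rfl⟩
      simpa using hy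
    · intro h
      exact ⟨_, h, by simp⟩
  constructor
  · intro h
    have := key a
    rw [h, Equiv.swap_apply_left] at this
    exact this
  · intro h
    ext x
    rw [key]
    rw [Equiv.swap_apply_def]
    split_ifs with h1 h2
    · subst h1; exact h.symm
    · subst h2; exact h
    · rfl

theorem aux_count (m : ℕ) (a b : Fin (2 * m)) (hab : a ≠ b) :
    (Finset.univ.filter (fun S : Finset (Fin (2 * m)) =>
      S.card = m ∧ (a ∈ S ↔ b ∈ S))).card = 2 * (2 * m - 2).choose m := by
  rw [← Finset.card_filter_add_card_filter_not (fun S => a ∈ S), two_mul (Nat.choose _ _)]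
  have h1 : ((Finset.univ.filter (fun S : Finset (Fin (2 * m)) =>
      S.card = m ∧ (a ∈ S ↔ b ∈ S))).filter (fun S => ¬ a ∈ S)).card
      = (2 * m - 2).choose m := by
    have : ((Finset.univ.filter (fun S : Finset (Fin (2 * m)) =>
      S.card = m ∧ (a ∈ S ↔ b ∈ S))).filter (fun S => ¬ a ∈ S))
      = Finset.powersetCard m ({a, b} : Finset (Fin (2 * m)))ᶜ := by
      ext S
      simp only [Finset.mem_filter, Finset.mem_univ, true_and, Finset.mem_powersetCard,
        Finset.subset_compl_comm (s := S), Finset.insert_subset_iff,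
        Finset.singleton_subset_iff, Finset.mem_compl]
      tauto
    rw [this, Finset.card_powersetCard, Finset.card_compl, Finset.card_pair hab, Fintype.card_fin]
  rw [h1]
  congr 1
  rw [← h1]
  refine Finset.card_bij (fun S _ => Sᶜ) ?_ ?_ ?_
  · intro S
    simp only [Finset.mem_filter, Finset.mem_univ, true_and, Finset.mem_compl,
      Finset.card_compl, Fintype.card_fin]
    rintro ⟨⟨h, h'⟩, h''⟩
    exact ⟨⟨by omega, by tauto⟩, by tauto⟩
  · intro S _ T _ h
    exact compl_injective h
  · intro S
    simp only [Finset.mem_filter, Finset.mem_univ, true_and]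
    rintro ⟨⟨h, h'⟩, h''⟩
    refine ⟨Sᶜ, ?_, compl_compl S⟩
    simp only [Finset.mem_compl, Finset.card_compl, Fintype.card_fin]
    exact ⟨⟨by omega, by tauto⟩, by tauto⟩

/-- For even `n ≥ 4` and a transposition `τ ∈ Sym(n)`, the proportion of
`(n/2)`-element subsets `S` of `{0, …, n-1}` with `τ(S) = S` equals
`1/3 + (n-4)/(6(n-1))`. -/
theorem stmt_6 (n : ℕ) (hn : 4 ≤ n) (hev : Even n)
    (τ : Equiv.Perm (Fin n)) (hτ : τ.IsSwap) :
    (Nat.card {S : Finset (Fin n) // S.card = n / 2 ∧ S.image τ = S} : ℚ) /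
        (n.choose (n / 2) : ℚ) =
      1 / 3 + ((n : ℚ) - 4) / (6 * ((n : ℚ) - 1)) := by
  obtain ⟨a, b, hab, rfl⟩ := hτ
  obtain ⟨m, hm⟩ := hev
  obtain ⟨k, rfl⟩ : ∃ k, m = k + 2 := ⟨m - 2, by omega⟩
  obtain rfl : n = 2 * (k + 2) := by omega
  have hd : 2 * (k + 2) / 2 = k + 2 := by omega
  rw [hd]
  simp only [aux_image]
  rw [Nat.card_eq_fintype_card, Fintype.card_subtype, aux_count _ a b hab]
  have e0 : (2 * (k + 2) - 2).choose (k + 2) = (2 * k + 2).choose k := by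
    have : 2 * (k + 2) - 2 = 2 * k + 2 := by omega
    rw [this]
    exact Nat.choose_symm_of_eq_add (by omega)
  have e1 := Nat.add_one_mul_choose_eq (2 * k + 2) k
  have e2 := Nat.add_one_mul_choose_eq (2 * k + 2 + 1) (k + 1)
  have e3 : (2 * (k + 2)).choose (k + 2) = (2 * k + 2 + 1 + 1).choose (k + 1 + 1) := rfl
  have hpos : 0 < (2 * (k + 2)).choose (k + 2) := Nat.choose_pos (by omega)
  rw [e0]
  rw [← e3] at e2
  generalize (2 * (k + 2)).choose (k + 2) = C at *
  generalize (2 * k + 2).choose k = A at *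
  generalize (2 * k + 2 + 1).choose (k + 1) = B at *
  have hB : 2 * B = C := by
    have : (k + 2) * (2 * B) = (k + 2) * C := by linarith
    exact Nat.eq_of_mul_eq_mul_left (by omega) this
  have hA : (2 * (k : ℚ) + 3) * (2 * A) = C * (k + 1) := by
    have : (2 * k + 3) * (2 * A) = C * (k + 1) := by rw [← hB]; linarith
    exact_mod_cast this
  have hC : (C : ℚ) ≠ 0 := by positivity
  have hk : (2 * (k : ℚ) + 3) ≠ 0 := by positivity
  have hr : (1 / 3 + (((2 * (k + 2) : ℕ) : ℚ) - 4) / (6 * (((2 * (k + 2) : ℕ) : ℚ) - 1)))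
      = (k + 1) / (2 * k + 3) := by
    push_cast
    have : (2 * ((k : ℚ) + 2) - 1) = 2 * k + 3 := by ring
    rw [this]
    field_simp
    ring
  rw [hr, div_eq_div_iff hC hk]
  push_cast
  linarith
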